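/- arXiv:2006.14093 — 6 statements merged into one kernel-verified Lean document; each statement's English description precedes it below -/
import Mathlib

section
/- For any index c with 1 ≤ c ≤ i ≤ j ≤ n, the eccentricity of vertex v_c in G(i,j) satisfies ecc(i,j,c) = max( d_P(1,c), d_P(c,i) + max_{i ≤ k ≤ n} d_{G(i,j)}(i,k) ). -/
/-- Path distance along `P` between vertices `a` and `b`. -/
noncomputable def dP {X : Type*} [MetricSpace X] (v : ℕ → X) (a b : ℕ) : ℝ :=
  ∑ m ∈ Finset.Ico (min a b) (max a b), dist (v m) (v (m + 1))

/-- Shortest-path distance in the augmented graph `G(i,j)`. -/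
noncomputable def dG {X : Type*} [MetricSpace X] (v : ℕ → X) (i j a b : ℕ) : ℝ :=
  min (dP v a b)
    (min (dP v a i + dist (v i) (v j) + dP v j b)
         (dP v a j + dist (v i) (v j) + dP v i b))

/-- Eccentricity of vertex `c` in `G(i,j)`: `max_{1 ≤ k ≤ n} dG(c,k)`. -/
noncomputable def ecc {X : Type*} [MetricSpace X] (v : ℕ → X) (n i j c : ℕ) : ℝ :=
  sSup ((fun k => dG v i j c k) '' Set.Icc 1 n)

/-- Radius of `G(i,j)`: `min_{1 ≤ c ≤ n} ecc(i,j,c)`. -/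
noncomputable def rad {X : Type*} [MetricSpace X] (v : ℕ → X) (n i j : ℕ) : ℝ :=
  sInf ((fun c => ecc v n i j c) '' Set.Icc 1 n)

/-- Optimal radius: `min_{1 ≤ i ≤ j ≤ n} rad(i,j)`. -/
noncomputable def rstar {X : Type*} [MetricSpace X] (v : ℕ → X) (n : ℕ) : ℝ :=
  sInf {x | ∃ i j : ℕ, 1 ≤ i ∧ i ≤ j ∧ j ≤ n ∧ x = rad v n i j}

theorem dP_eq_aux {X : Type*} [MetricSpace X] (v : ℕ → X) (a b : ℕ) (h : a ≤ b) :
    dP v a b = (∑ m ∈ Finset.range b, dist (v m) (v (m + 1)))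
      - ∑ m ∈ Finset.range a, dist (v m) (v (m + 1)) := by
  unfold dP
  rw [min_eq_left h, max_eq_right h, Finset.sum_Ico_eq_sub _ h]

theorem dP_comm_aux {X : Type*} [MetricSpace X] (v : ℕ → X) (a b : ℕ) :
    dP v a b = dP v b a := by
  unfold dP
  rw [min_comm, max_comm]

theorem dP_nonneg_aux {X : Type*} [MetricSpace X] (v : ℕ → X) (a b : ℕ) :
    0 ≤ dP v a b := Finset.sum_nonneg fun _ _ => dist_nonneg

theorem dP_add_aux {X : Type*} [MetricSpace X] (v : ℕ → X) (a b c : ℕ) (h : a ≤ b)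
    (h' : b ≤ c) : dP v a c = dP v a b + dP v b c := by
  rw [dP_eq_aux v a b h, dP_eq_aux v b c h', dP_eq_aux v a c (h.trans h')]
  ring

theorem dG_nonneg_aux {X : Type*} [MetricSpace X] (v : ℕ → X) (i j a b : ℕ) :
    0 ≤ dG v i j a b := by
  have h := dP_nonneg_aux v
  have hD : 0 ≤ dist (v i) (v j) := dist_nonneg
  unfold dG
  refine le_min (h _ _) (le_min ?_ ?_)
  · linarith [h a i, h j b]
  · linarith [h a j, h i b]

theorem dG_shift_aux {X : Type*} [MetricSpace X] (v : ℕ → X) (c i j k : ℕ)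
    (hci : c ≤ i) (hij : i ≤ j) (hik : i ≤ k) :
    dG v i j c k = dP v c i + dG v i j i k := by
  have h0 : dP v i i = 0 := by simp [dP]
  unfold dG
  rw [dP_add_aux v c i k hci hik, dP_add_aux v c i j hci hij, h0,
    ← min_add_add_left, ← min_add_add_left]
  congr 2 <;> ring

theorem dG_one_aux {X : Type*} [MetricSpace X] (v : ℕ → X) (c i j : ℕ)
    (h1c : 1 ≤ c) (hci : c ≤ i) (hij : i ≤ j) :
    dG v i j c 1 = dP v 1 c := by
  have h := dP_nonneg_aux v
  have hD : 0 ≤ dist (v i) (v j) := dist_nonneg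
  unfold dG
  rw [dP_comm_aux v c 1, dP_comm_aux v j 1, dP_comm_aux v i 1,
    dP_add_aux v 1 c j h1c (hci.trans hij), dP_add_aux v 1 c i h1c hci]
  refine min_eq_left (le_min ?_ ?_)
  · linarith [h c i, h c j]
  · linarith [h c i, h c j]

/-- For any `1 ≤ c ≤ i ≤ j ≤ n`,
`ecc(i,j,c) = max( dP(1,c), dP(c,i) + max_{i ≤ k ≤ n} dG(i,j)(i,k) )`. -/
theorem stmt_0 {X : Type*} [MetricSpace X] (n : ℕ) (hn : 2 ≤ n) (v : ℕ → X)
    (hv : Set.InjOn v (Set.Icc 1 n))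
    (c i j : ℕ) (h1c : 1 ≤ c) (hci : c ≤ i) (hij : i ≤ j) (hjn : j ≤ n) :
    ecc v n i j c =
      max (dP v 1 c) (dP v c i + sSup ((fun k => dG v i j i k) '' Set.Icc i n)) := by
  have bdd : ∀ (a l : ℕ), BddAbove ((fun k => dG v i j a k) '' Set.Icc l n) :=
    fun a l => ((Set.finite_Icc l n).image _).bddAbove
  have hS : 0 ≤ sSup ((fun k => dG v i j i k) '' Set.Icc i n) := by
    refine (dG_nonneg_aux v i j i i).trans (le_csSup (bdd i i) ⟨i, ⟨le_rfl, by omega⟩, rfl⟩)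
  unfold ecc
  apply le_antisymm
  · refine csSup_le ⟨_, 1, ⟨le_rfl, by omega⟩, rfl⟩ ?_
    rintro _ ⟨k, ⟨hk1, hkn⟩, rfl⟩
    show dG v i j c k ≤ _
    have hle : dG v i j c k ≤ dP v c k := min_le_left _ _
    rcases le_total k c with hkc | hck
    · refine le_max_of_le_left (hle.trans ?_)
      rw [dP_comm_aux, dP_add_aux v 1 k c hk1 hkc]
      linarith [dP_nonneg_aux v 1 k]
    rcases le_total k i with hki | hik
    · refine le_max_of_le_right (hle.trans ?_)
      rw [dP_add_aux v c k i hck hki]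
      linarith [dP_nonneg_aux v k i]
    · refine le_max_of_le_right ?_
      rw [dG_shift_aux v c i j k hci hij hik]
      have := le_csSup (bdd i i) ⟨k, ⟨hik, hkn⟩, rfl⟩
      simp only at this
      linarith
  · refine max_le ?_ ?_
    · rw [← dG_one_aux v c i j h1c hci hij]
      exact le_csSup (bdd c 1) ⟨1, ⟨le_rfl, by omega⟩, rfl⟩
    · rw [← le_sub_iff_add_le']
      refine csSup_le ⟨_, i, ⟨le_rfl, by omega⟩, rfl⟩ ?_
      rintro _ ⟨k, ⟨hik, hkn⟩, rfl⟩
      show dG v i j i k ≤ _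
      have := le_csSup (bdd c 1) ⟨k, ⟨by omega, hkn⟩, rfl⟩
      simp only at this
      rw [dG_shift_aux v c i j k hci hij hik] at this
      linarith
end

section
/- The optimal radius satisfies r* = min( min_{1 ≤ i ≤ n−1} r_i , min_{2 ≤ j ≤ n} s_j ); that is, the smaller of the two candidate values produced for Case 1.1 and Case 1.2 equals the minimum possible radius over all ways of adding one edge to P. -/
/-- `λ_i = min_{i ≤ j ≤ n} max_{i ≤ k ≤ n} dG(i,j)(i,k)`. -/
noncomputable def lam {X : Type*} [MetricSpace X] (v : ℕ → X) (n i : ℕ) : ℝ :=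
  sInf ((fun j => sSup ((fun k => dG v i j i k) '' Set.Icc i n)) '' Set.Icc i n)

/-- `r_i = min_{1 ≤ c ≤ i} max( dP(1,c), dP(c,i) + λ_i )`. -/
noncomputable def rI {X : Type*} [MetricSpace X] (v : ℕ → X) (n i : ℕ) : ℝ :=
  sInf ((fun c => max (dP v 1 c) (dP v c i + lam v n i)) '' Set.Icc 1 i)

/-- `μ_j = min_{1 ≤ i ≤ j} max_{1 ≤ k ≤ j} dG(i,j)(j,k)`. -/
noncomputable def mu {X : Type*} [MetricSpace X] (v : ℕ → X) (n j : ℕ) : ℝ :=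
  sInf ((fun i => sSup ((fun k => dG v i j j k) '' Set.Icc 1 j)) '' Set.Icc 1 j)

/-- `s_j = min_{j ≤ c ≤ n} max( dP(c,n), dP(j,c) + μ_j )`. -/
noncomputable def sJ {X : Type*} [MetricSpace X] (v : ℕ → X) (n j : ℕ) : ℝ :=
  sInf ((fun c => max (dP v c n) (dP v j c + mu v n j)) '' Set.Icc j n)

noncomputable def pos {X : Type*} [MetricSpace X] (v : ℕ → X) (k : ℕ) : ℝ :=
  ∑ m ∈ Finset.range k, dist (v m) (v (m + 1))

section
variable {X : Type*} [MetricSpace X] (v : ℕ → X)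

lemma pos_mono : Monotone (pos v) := by
  apply monotone_nat_of_le_succ
  intro k
  unfold pos
  rw [Finset.sum_range_succ]
  linarith [dist_nonneg (x := v k) (y := v (k+1))]

lemma dP_le {a b : ℕ} (h : a ≤ b) : dP v a b = pos v b - pos v a := by
  unfold dP pos
  rw [min_eq_left h, max_eq_right h, Finset.sum_Ico_eq_sub _ h]

lemma dP_ge {a b : ℕ} (h : b ≤ a) : dP v a b = pos v a - pos v b := by
  unfold dP pos
  rw [min_eq_right h, max_eq_left h, Finset.sum_Ico_eq_sub _ h]

lemma dP_abs (a b : ℕ) : dP v a b = |pos v a - pos v b| := by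
  rcases le_total a b with h | h
  · rw [dP_le v h, abs_sub_comm, abs_of_nonneg]
    linarith [pos_mono v h]
  · rw [dP_ge v h, abs_of_nonneg]
    linarith [pos_mono v h]

lemma dP_nonneg (a b : ℕ) : 0 ≤ dP v a b := by
  rw [dP_abs]; exact abs_nonneg _

lemma dP_comm (a b : ℕ) : dP v a b = dP v b a := by
  rw [dP_abs, dP_abs, abs_sub_comm]

lemma dP_tri (a b c : ℕ) : dP v a c ≤ dP v a b + dP v b c := by
  simp only [dP_abs]; exact abs_sub_le _ _ _

lemma dP_add {a b c : ℕ} (h : a ≤ b) (h' : b ≤ c) : dP v a c = dP v a b + dP v b c := by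
  rw [dP_le v h, dP_le v h', dP_le v (h.trans h')]; ring

lemma dP_add' {a b c : ℕ} (h : b ≤ a) (h' : c ≤ b) : dP v a c = dP v a b + dP v b c := by
  rw [dP_ge v h, dP_ge v h', dP_ge v (h'.trans h)]; ring

lemma dP_self (a : ℕ) : dP v a a = 0 := by
  rw [dP_le v le_rfl]; ring

lemma dist_le_dP (a b : ℕ) : dist (v a) (v b) ≤ dP v a b := by
  wlog h : a ≤ b generalizing a b
  · rw [dist_comm, dP_comm]; exact this b a (by omega)
  unfold dP
  rw [min_eq_left h, max_eq_right h]
  exact dist_le_Ico_sum_dist v h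

lemma dG_le_dP (i j a b : ℕ) : dG v i j a b ≤ dP v a b := min_le_left _ _

lemma dG_nonneg (i j a b : ℕ) : 0 ≤ dG v i j a b := by
  unfold dG
  have := @dist_nonneg _ _ (v i) (v j)
  refine le_min (dP_nonneg ..) (le_min ?_ ?_)
  · linarith [dP_nonneg v a i, dP_nonneg v j b]
  · linarith [dP_nonneg v a j, dP_nonneg v i b]

lemma dG_tri (i j a b k : ℕ) : dG v i j a k ≤ dP v a b + dG v i j b k := by
  unfold dG
  rw [← min_add_add_left, ← min_add_add_left]
  have h1 := dP_tri v a b k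
  have h2 := dP_tri v a b i
  have h3 := dP_tri v a b j
  exact min_le_min h1 (min_le_min (by linarith) (by linarith))

lemma sInf_img_le {S : Set ℕ} (hS : S.Finite) (f : ℕ → ℝ) {a : ℕ} (ha : a ∈ S) :
    sInf (f '' S) ≤ f a := csInf_le (hS.image f).bddBelow ⟨a, ha, rfl⟩

lemma le_sSup_img {S : Set ℕ} (hS : S.Finite) (f : ℕ → ℝ) {a : ℕ} (ha : a ∈ S) :
    f a ≤ sSup (f '' S) := le_csSup (hS.image f).bddAbove ⟨a, ha, rfl⟩

lemma sInf_img_mem {S : Set ℕ} (hS : S.Finite) (f : ℕ → ℝ) (hne : S.Nonempty) :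
    ∃ a ∈ S, f a = sInf (f '' S) := (hne.image f).csInf_mem (hS.image f)

lemma sSup_img_le {S : Set ℕ} (f : ℕ → ℝ) (hne : S.Nonempty) {M : ℝ}
    (h : ∀ a ∈ S, f a ≤ M) : sSup (f '' S) ≤ M := by
  apply csSup_le (hne.image f)
  rintro _ ⟨a, ha, rfl⟩
  exact h a ha

lemma rstar_le {n i j c : ℕ} (hi : 1 ≤ i) (hij : i ≤ j) (hj : j ≤ n) (hc : c ∈ Set.Icc 1 n)
    {M : ℝ} (h : ∀ k ∈ Set.Icc 1 n, dG v i j c k ≤ M) : rstar v n ≤ M := by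
  have hfin : {x | ∃ i j : ℕ, 1 ≤ i ∧ i ≤ j ∧ j ≤ n ∧ x = rad v n i j}.Finite := by
    apply (((Set.finite_Icc 1 n).prod (Set.finite_Icc 1 n)).image
      (fun q : ℕ × ℕ => rad v n q.1 q.2)).subset
    rintro x ⟨i, j, h1, h2, h3, rfl⟩
    exact ⟨(i, j), ⟨⟨h1, h2.trans h3⟩, ⟨h1.trans h2, h3⟩⟩, rfl⟩
  have h1 : rstar v n ≤ rad v n i j := csInf_le hfin.bddBelow ⟨i, j, hi, hij, hj, rfl⟩
  have h2 : rad v n i j ≤ ecc v n i j c := sInf_img_le (Set.finite_Icc 1 n) _ hc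
  have h3 : ecc v n i j c ≤ M := sSup_img_le _ ⟨c, hc⟩ h
  linarith

lemma rstar_le_rI {n i : ℕ} (hi : 1 ≤ i) (hin : i ≤ n) : rstar v n ≤ rI v n i := by
  obtain ⟨c, hc, hce⟩ := sInf_img_mem (Set.finite_Icc 1 i)
    (fun c => max (dP v 1 c) (dP v c i + lam v n i)) ⟨1, le_rfl, hi⟩
  obtain ⟨j, hj, hje⟩ := sInf_img_mem (Set.finite_Icc i n)
    (fun j => sSup ((fun k => dG v i j i k) '' Set.Icc i n)) ⟨i, le_rfl, hin⟩
  have hL : ∀ k ∈ Set.Icc i n, dG v i j i k ≤ lam v n i := by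
    intro k hk
    have := le_sSup_img (Set.finite_Icc i n) (fun k => dG v i j i k) hk
    unfold lam
    rw [← hje]; exact this
  change max (dP v 1 c) (dP v c i + lam v n i) = rI v n i at hce
  have m1 := le_max_left (dP v 1 c) (dP v c i + lam v n i)
  have m2 := le_max_right (dP v 1 c) (dP v c i + lam v n i)
  rw [hce] at m1 m2
  obtain ⟨c1, c2⟩ := hc
  refine rstar_le v hi hj.1 hj.2 (c := c) ⟨c1, by omega⟩ ?_
  rintro k ⟨k1, k2⟩
  rcases le_total k i with hk | hk
  · have := dG_le_dP v i j c k
    rcases le_total k c with h | h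
    · have e := dP_add v k1 h
      rw [dP_comm v k c] at e
      linarith [dP_nonneg v 1 k]
    · have e := dP_add v h hk
      linarith [dP_nonneg v k i, hL i ⟨le_rfl, hin⟩, dG_nonneg v i j i i]
  · linarith [dG_tri v i j c i k, hL k ⟨hk, k2⟩]

lemma rstar_le_sJ {n j : ℕ} (hj1 : 1 ≤ j) (hjn : j ≤ n) : rstar v n ≤ sJ v n j := by
  obtain ⟨c, hc, hce⟩ := sInf_img_mem (Set.finite_Icc j n)
    (fun c => max (dP v c n) (dP v j c + mu v n j)) ⟨j, le_rfl, hjn⟩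
  obtain ⟨i, hi, hie⟩ := sInf_img_mem (Set.finite_Icc 1 j)
    (fun i => sSup ((fun k => dG v i j j k) '' Set.Icc 1 j)) ⟨j, hj1, le_rfl⟩
  have hL : ∀ k ∈ Set.Icc 1 j, dG v i j j k ≤ mu v n j := by
    intro k hk
    have := le_sSup_img (Set.finite_Icc 1 j) (fun k => dG v i j j k) hk
    unfold mu
    rw [← hie]; exact this
  change max (dP v c n) (dP v j c + mu v n j) = sJ v n j at hce
  have m1 := le_max_left (dP v c n) (dP v j c + mu v n j)
  have m2 := le_max_right (dP v c n) (dP v j c + mu v n j)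
  rw [hce] at m1 m2
  obtain ⟨c1, c2⟩ := hc
  refine rstar_le v hi.1 hi.2 hjn (c := c) ⟨by omega, c2⟩ ?_
  rw [dP_comm v j c] at m2
  rintro k ⟨k1, k2⟩
  rcases le_total j k with hk | hk
  · have := dG_le_dP v i j c k
    rcases le_total c k with h | h
    · have e := dP_add v h k2
      linarith [dP_nonneg v k n]
    · have e := dP_add' v h hk
      linarith [dP_nonneg v k j, hL j ⟨hj1, le_rfl⟩, dG_nonneg v i j j j]
  · linarith [dG_tri v i j c j k, hL k ⟨k1, hk⟩]

lemma rI_le {n i j c : ℕ} (hc : 1 ≤ c) (hci : c ≤ i) (hij : i ≤ j) (hj : j ≤ n) {E : ℝ}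
    (H : ∀ k ∈ Set.Icc 1 n, dG v i j c k ≤ E) : rI v n i ≤ E := by
  have h1 : rI v n i ≤ max (dP v 1 c) (dP v c i + lam v n i) :=
    sInf_img_le (Set.finite_Icc 1 i) (fun c => max (dP v 1 c) (dP v c i + lam v n i)) ⟨hc, hci⟩
  have h2 : lam v n i ≤ sSup ((fun k => dG v i j i k) '' Set.Icc i n) :=
    sInf_img_le (Set.finite_Icc i n)
      (fun j => sSup ((fun k => dG v i j i k) '' Set.Icc i n)) ⟨hij, hj⟩
  have h3 : sSup ((fun k => dG v i j i k) '' Set.Icc i n) ≤ E - dP v c i := by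
    refine sSup_img_le _ (Set.nonempty_Icc.2 (hij.trans hj)) ?_
    rintro k ⟨hk, hkn⟩
    have := H k ⟨by omega, hkn⟩
    have e : dG v i j c k = dP v c i + dG v i j i k := by
      unfold dG
      rw [← min_add_add_left, ← min_add_add_left, dP_add v hci hk, dP_add v hci hij, dP_self]
      ring_nf
    linarith
  refine h1.trans (max_le ?_ (by linarith))
  refine le_trans ?_ (H 1 ⟨le_rfl, by omega⟩)
  have D := @dist_nonneg _ _ (v i) (v j)
  unfold dG
  rw [dP_comm v 1 c]
  refine le_min le_rfl (le_min ?_ ?_)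
  · rw [dP_add' v (hci.trans hij) hc]; linarith [dP_nonneg v c i, dP_nonneg v j c]
  · rw [dP_add' v hci hc]; linarith [dP_nonneg v c j, dP_nonneg v i c]

lemma sJ_le {n i j c : ℕ} (hi : 1 ≤ i) (hij : i ≤ j) (hjc : j ≤ c) (hc : c ≤ n) {E : ℝ}
    (H : ∀ k ∈ Set.Icc 1 n, dG v i j c k ≤ E) : sJ v n j ≤ E := by
  have h1 : sJ v n j ≤ max (dP v c n) (dP v j c + mu v n j) :=
    sInf_img_le (Set.finite_Icc j n) (fun c => max (dP v c n) (dP v j c + mu v n j)) ⟨hjc, hc⟩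
  have h2 : mu v n j ≤ sSup ((fun k => dG v i j j k) '' Set.Icc 1 j) :=
    sInf_img_le (Set.finite_Icc 1 j)
      (fun i => sSup ((fun k => dG v i j j k) '' Set.Icc 1 j)) ⟨hi, hij⟩
  rw [dP_comm v j c] at h1
  have h3 : sSup ((fun k => dG v i j j k) '' Set.Icc 1 j) ≤ E - dP v c j := by
    refine sSup_img_le _ (Set.nonempty_Icc.2 (hi.trans hij)) ?_
    rintro k ⟨hk, hkj⟩
    have := H k ⟨hk, by omega⟩
    have e : dG v i j c k = dP v c j + dG v i j j k := by
      unfold dG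
      rw [← min_add_add_left, ← min_add_add_left, dP_add' v hjc hkj, dP_add' v hjc hij, dP_self]
      ring_nf
    linarith
  refine h1.trans (max_le ?_ (by linarith))
  refine le_trans ?_ (H n ⟨by omega, le_rfl⟩)
  have D := @dist_nonneg _ _ (v i) (v j)
  unfold dG
  refine le_min le_rfl (le_min ?_ ?_)
  · rw [dP_add v hjc hc]; linarith [dP_nonneg v c i, dP_nonneg v j c]
  · rw [dP_add v (hij.trans hjc) hc]; linarith [dP_nonneg v c j, dP_nonneg v i c]

lemma main_ge {n i j c : ℕ} (hn : 2 ≤ n) (hi : 1 ≤ i) (hij : i ≤ j) (hj : j ≤ n) (hc : 1 ≤ c)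
    (hcn : c ≤ n) {E : ℝ} (H : ∀ k ∈ Set.Icc 1 n, dG v i j c k ≤ E) :
    (∃ a ∈ Set.Icc 1 (n - 1), rI v n a ≤ E) ∨ (∃ b ∈ Set.Icc 2 n, sJ v n b ≤ E) := by
  -- the case where the edge is useless
  have useless : (∀ k ∈ Set.Icc 1 n, dP v c k ≤ E) →
      (∃ a ∈ Set.Icc 1 (n - 1), rI v n a ≤ E) ∨ (∃ b ∈ Set.Icc 2 n, sJ v n b ≤ E) := by
    intro hP
    have H' : ∀ k ∈ Set.Icc 1 n, dG v c c c k ≤ E :=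
      fun k hk => (dG_le_dP v c c c k).trans (hP k hk)
    by_cases h : c ≤ n - 1
    · exact Or.inl ⟨c, ⟨hc, h⟩, rI_le v hc le_rfl le_rfl hcn H'⟩
    · exact Or.inr ⟨c, ⟨by omega, hcn⟩, sJ_le v hc le_rfl le_rfl hcn H'⟩
  have D := @dist_nonneg _ _ (v i) (v j)
  by_cases hd : i = j
  · subst hd
    apply useless
    intro k hk
    refine le_trans ?_ (H k hk)
    unfold dG
    have := dP_tri v c i k
    exact le_min le_rfl (le_min (by linarith) (by linarith))
  by_cases h1 : c ≤ i
  · exact Or.inl ⟨i, ⟨hi, by omega⟩, rI_le v hc h1 hij hj H⟩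
  by_cases h2 : j ≤ c
  · exact Or.inr ⟨j, ⟨by omega, hj⟩, sJ_le v hi hij h2 hcn H⟩
  push Not at h1 h2
  by_cases h3 : dP v c j + dist (v i) (v j) ≤ dP v c i
  · refine Or.inr ⟨c, ⟨by omega, hcn⟩, sJ_le v hi h1.le le_rfl hcn fun k hk => le_trans ?_ (H k hk)⟩
    have t := dist_triangle (v i) (v j) (v c)
    have t2 := dist_le_dP v j c
    rw [dP_comm v j c] at t2
    have := dP_tri v c j k
    unfold dG
    rw [dP_self]
    refine le_min (min_le_left _ _) (le_min ?_ ?_)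
    · exact (min_le_left _ _).trans (by linarith)
    · exact (min_le_right _ _).trans ((min_le_right _ _).trans (by linarith))
  by_cases h4 : dP v c i + dist (v i) (v j) ≤ dP v c j
  · refine Or.inl ⟨c, ⟨hc, by omega⟩, rI_le v hc le_rfl h2.le hj fun k hk => le_trans ?_ (H k hk)⟩
    have t := dist_triangle (v c) (v i) (v j)
    have t2 := dist_le_dP v c i
    have := dP_tri v c i k
    unfold dG
    rw [dP_self]
    refine le_min (min_le_left _ _) (le_min ?_ ?_)
    · exact (min_le_right _ _).trans ((min_le_left _ _).trans (by linarith))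
    · exact (min_le_left _ _).trans (by linarith)
  apply useless
  intro k hk
  refine le_trans ?_ (H k hk)
  have := dP_tri v c i k
  have := dP_tri v c j k
  unfold dG
  exact le_min le_rfl (le_min (by linarith) (by linarith))

end

/-- `r* = min( min_{1 ≤ i ≤ n−1} r_i , min_{2 ≤ j ≤ n} s_j )`. -/
theorem stmt_2 {X : Type*} [MetricSpace X] (n : ℕ) (hn : 2 ≤ n) (v : ℕ → X)
    (hv : Set.InjOn v (Set.Icc 1 n)) :
    rstar v n =
      min (sInf ((fun i => rI v n i) '' Set.Icc 1 (n - 1)))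
          (sInf ((fun j => sJ v n j) '' Set.Icc 2 n)) := by
  apply le_antisymm
  · apply le_min
    · apply le_csInf ((Set.nonempty_Icc.2 (by omega)).image _)
      rintro _ ⟨i, ⟨h1, h2⟩, rfl⟩
      exact rstar_le_rI v h1 (by omega)
    · apply le_csInf ((Set.nonempty_Icc.2 hn).image _)
      rintro _ ⟨j, ⟨h1, h2⟩, rfl⟩
      exact rstar_le_sJ v (by omega) h2
  · refine le_csInf (Exists.intro (rad v n 1 1) ⟨1, 1, le_rfl, le_rfl, by omega, rfl⟩) ?_
    rintro _ ⟨i, j, hi, hij, hj, rfl⟩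
    apply le_csInf ((Set.nonempty_Icc.2 (by omega)).image _)
    rintro _ ⟨c, ⟨hc, hcn⟩, rfl⟩
    have H : ∀ k ∈ Set.Icc 1 n, dG v i j c k ≤ ecc v n i j c :=
      fun k hk => le_sSup_img (Set.finite_Icc 1 n) (fun k => dG v i j c k) hk
    rcases main_ge v hn hi hij hj hc hcn H with ⟨a, ha, h⟩ | ⟨b, hb, h⟩
    · exact (min_le_left _ _).trans
        ((sInf_img_le (Set.finite_Icc 1 (n - 1)) (fun i => rI v n i) ha).trans h)
    · exact (min_le_right _ _).trans
        ((sInf_img_le (Set.finite_Icc 2 n) (fun j => sJ v n j) hb).trans h)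
end

section
/- Suppose 1 ≤ i* < j* ≤ n, rad(i*,j*) = r*, and there is a center c* of G(i*,j*) with c* ≥ j* (i.e., ecc(i*,j*,c*) = r*). Then min_{2 ≤ j ≤ n} s_j = r*. -/
section helpers
variable {X : Type*} [MetricSpace X]

lemma h_dP_le (v : ℕ → X) {a b : ℕ} (h : a ≤ b) :
    dP v a b = (∑ m ∈ Finset.range b, dist (v m) (v (m + 1)))
      - ∑ m ∈ Finset.range a, dist (v m) (v (m + 1)) := by
  unfold dP
  rw [min_eq_left h, max_eq_right h, Finset.sum_Ico_eq_sub _ h]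

lemma h_dP_comm (v : ℕ → X) (a b : ℕ) : dP v a b = dP v b a := by
  unfold dP
  rw [min_comm, max_comm]

lemma h_dP_nonneg (v : ℕ → X) (a b : ℕ) : 0 ≤ dP v a b :=
  Finset.sum_nonneg fun _ _ => dist_nonneg

lemma h_dP_add (v : ℕ → X) {a b c : ℕ} (h : a ≤ b) (h' : b ≤ c) :
    dP v a c = dP v a b + dP v b c := by
  rw [h_dP_le v h, h_dP_le v h', h_dP_le v (h.trans h')]; ring

lemma h_dG_nonneg (v : ℕ → X) (i j a b : ℕ) : 0 ≤ dG v i j a b := by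
  have h := h_dP_nonneg v
  unfold dG
  refine le_min (h _ _) (le_min ?_ ?_)
  · have := h a i; have := h j b; positivity
  · have := h a j; have := h i b; positivity

lemma h_dG_split (v : ℕ → X) {i j c k : ℕ} (hi : i ≤ j) (hk : k ≤ j) (hc : j ≤ c) :
    dG v i j c k = dP v j c + dG v i j j k := by
  unfold dG
  rw [h_dP_comm v c k, h_dP_comm v c i, h_dP_comm v c j, h_dP_comm v j i, h_dP_comm v j k,
    h_dP_add v hk hc, h_dP_add v hi hc, ← min_add_add_left, ← min_add_add_left]
  have : dP v j j = 0 := by simp [dP]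
  rw [this]
  congr 1
  · ring
  · congr 1 <;> ring

lemma h_dG_end (v : ℕ → X) {i j c n : ℕ} (hi : i ≤ j) (hc : j ≤ c) (hn : c ≤ n) :
    dG v i j c n = dP v c n := by
  unfold dG
  have h := h_dP_nonneg v
  have hd : 0 ≤ dist (v i) (v j) := dist_nonneg
  apply min_eq_left
  apply le_min
  · rw [h_dP_add v hc hn]; linarith [h c i, h j c]
  · rw [h_dP_add v (hi.trans hc) hn]; linarith [h c j, h i c]

lemma h_ecc_nonneg (v : ℕ → X) (n i j c : ℕ) : 0 ≤ ecc v n i j c := by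
  apply Real.sSup_nonneg
  rintro _ ⟨k, -, rfl⟩
  exact h_dG_nonneg _ _ _ _ _

lemma h_rad_nonneg (v : ℕ → X) (n i j : ℕ) : 0 ≤ rad v n i j := by
  apply Real.sInf_nonneg
  rintro _ ⟨k, -, rfl⟩
  exact h_ecc_nonneg _ _ _ _ _

lemma h_rstar_le (v : ℕ → X) {n i j c : ℕ} (hi : 1 ≤ i) (hij : i ≤ j) (hjc : j ≤ c)
    (hc : c ≤ n) : rstar v n ≤ ecc v n i j c := by
  have h1 : rstar v n ≤ rad v n i j := by
    apply csInf_le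
    · refine ⟨0, ?_⟩
      rintro _ ⟨i, j, -, -, -, rfl⟩
      exact h_rad_nonneg _ _ _ _
    · exact ⟨i, j, hi, hij, hjc.trans hc, rfl⟩
  refine h1.trans (csInf_le ((Set.finite_Icc 1 n).image _).bddBelow ?_)
  exact ⟨c, ⟨by omega, hc⟩, rfl⟩

lemma h_lower (v : ℕ → X) {n j c : ℕ} (hj : 1 ≤ j) (hjc : j ≤ c) (hc : c ≤ n) :
    rstar v n ≤ max (dP v c n) (dP v j c + mu v n j) := by
  have hne : (Set.Icc 1 j).Nonempty := ⟨j, hj, le_rfl⟩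
  obtain ⟨i, ⟨hi, hij⟩, hmu⟩ := (hne.image
    (fun i => sSup ((fun k => dG v i j j k) '' Set.Icc 1 j))).csInf_mem
      ((Set.finite_Icc 1 j).image _)
  change sSup ((fun k => dG v i j j k) '' Set.Icc 1 j) = mu v n j at hmu
  have hle : ∀ k, 1 ≤ k → k ≤ j → dG v i j j k ≤ mu v n j := by
    intro k h1 h2
    rw [← hmu]
    exact le_csSup ((Set.finite_Icc 1 j).image _).bddAbove ⟨k, ⟨h1, h2⟩, rfl⟩
  have hmu0 : 0 ≤ mu v n j := (h_dG_nonneg v i j j j).trans (hle j hj le_rfl)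
  refine (h_rstar_le v hi hij hjc hc).trans ?_
  apply csSup_le (Set.Nonempty.image _ (Set.nonempty_Icc.2 (by omega : 1 ≤ n)))
  rintro _ ⟨k, ⟨hk1, hkn⟩, rfl⟩
  change dG v i j c k ≤ _
  rcases le_total k j with h | h
  · rw [h_dG_split v hij h hjc]
    exact le_max_of_le_right (by linarith [hle k hk1 h])
  · have h0 : dG v i j c k ≤ dP v c k := min_le_left _ _
    rcases le_total k c with h' | h'
    · apply le_max_of_le_right
      rw [h_dP_comm] at h0
      have := h_dP_add v h h'
      linarith [h_dP_nonneg v j k]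
    · apply le_max_of_le_left
      have := h_dP_add v h' hkn
      linarith [h_dP_nonneg v k n]

lemma h_upper (v : ℕ → X) {n i j c : ℕ} (hi : 1 ≤ i) (hij : i ≤ j) (hjc : j ≤ c)
    (hc : c ≤ n) : max (dP v c n) (dP v j c + mu v n j) ≤ ecc v n i j c := by
  have hle : ∀ k, 1 ≤ k → k ≤ n → dG v i j c k ≤ ecc v n i j c := fun k h1 h2 =>
    le_csSup ((Set.finite_Icc 1 n).image _).bddAbove ⟨k, ⟨h1, h2⟩, rfl⟩
  apply max_le
  · rw [← h_dG_end v hij hjc hc]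
    exact hle n (by omega) le_rfl
  · have h1 : mu v n j ≤ sSup ((fun k => dG v i j j k) '' Set.Icc 1 j) :=
      csInf_le ((Set.finite_Icc 1 j).image _).bddBelow ⟨i, ⟨hi, hij⟩, rfl⟩
    have h2 : sSup ((fun k => dG v i j j k) '' Set.Icc 1 j) ≤ ecc v n i j c - dP v j c := by
      apply csSup_le (Set.Nonempty.image _ (Set.nonempty_Icc.2 (by omega : 1 ≤ j)))
      rintro _ ⟨k, ⟨hk1, hkj⟩, rfl⟩
      have := hle k hk1 (by omega)
      rw [h_dG_split v hij hkj hjc] at this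
      change dG v i j j k ≤ _
      linarith
    linarith

end helpers

/-- if an optimal `G(i*,j*)` has a center `c* ≥ j*`, then
`min_{2 ≤ j ≤ n} s_j = r*`. -/
theorem stmt_5 {X : Type*} [MetricSpace X] (n : ℕ) (hn : 2 ≤ n) (v : ℕ → X)
    (hv : Set.InjOn v (Set.Icc 1 n))
    (istar jstar cstar : ℕ)
    (hi : 1 ≤ istar) (hij : istar < jstar) (hjn : jstar ≤ n)
    (hopt : rad v n istar jstar = rstar v n)
    (hcj : jstar ≤ cstar) (hcn : cstar ≤ n)
    (hcenter : ecc v n istar jstar cstar = rstar v n) :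
    sInf ((fun j => sJ v n j) '' Set.Icc 2 n) = rstar v n := by
  apply le_antisymm
  · rw [← hcenter]
    refine le_trans ?_ (h_upper v hi hij.le hcj hcn)
    refine (csInf_le ((Set.finite_Icc 2 n).image _).bddBelow
      ⟨jstar, ⟨by omega, hjn⟩, rfl⟩).trans ?_
    exact csInf_le ((Set.finite_Icc jstar n).image _).bddBelow ⟨cstar, ⟨hcj, hcn⟩, rfl⟩
  · apply le_csInf (Set.Nonempty.image _ (Set.nonempty_Icc.2 hn))
    rintro _ ⟨j, ⟨hj, hj'⟩, rfl⟩
    apply le_csInf (Set.Nonempty.image _ (Set.nonempty_Icc.2 hj'))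
    rintro _ ⟨c, ⟨h1, h2⟩, rfl⟩
    exact h_lower v (by omega) h1 h2
end

section
/- Let 1 ≤ i < c < a < j ≤ n and let r = rad(i,j). Suppose ecc(i,j,c) = r and d_{G(i,j)}(c,a) = r. Then the subpath of P from v_c to v_j is not a shortest path from v_c to v_j in G(i,j); that is, d_{G(i,j)}(c,j) < d_P(c,j), and consequently d_{G(i,j)}(c,j) = d_P(i,c) + dist(v_i,v_j). -/
/-- in Case 2.3, the subpath of `P` from `v_c` to `v_j` is not a
shortest path in `G(i,j)`; the shortest path uses the added edge. -/
theorem stmt_13 {X : Type*} [MetricSpace X] (n : ℕ) (hn : 2 ≤ n) (v : ℕ → X)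
    (hv : Set.InjOn v (Set.Icc 1 n))
    (i c a j : ℕ) (hi : 1 ≤ i) (hic : i < c) (hca : c < a) (haj : a < j) (hjn : j ≤ n)
    (r : ℝ) (hr : r = rad v n i j)
    (hcenter : ecc v n i j c = r)
    (hfar : dG v i j c a = r) :
    dG v i j c j < dP v c j ∧ dG v i j c j = dP v i c + dist (v i) (v j) := by
  have hbdd : BddAbove ((fun k => dG v i j c k) '' Set.Icc 1 n) :=
    ((Set.finite_Icc 1 n).image _).bddAbove
  have h1 : dG v i j c j ≤ ecc v n i j c :=
    le_csSup hbdd ⟨j, ⟨by omega, hjn⟩, rfl⟩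
  have h2 : dG v i j c a ≤ dP v c a := min_le_left _ _
  have h3 : dP v c a < dP v c j := by
    unfold dP
    rw [min_eq_left hca.le, max_eq_right hca.le, min_eq_left (hca.trans haj).le,
      max_eq_right (hca.trans haj).le, ← Finset.sum_Ico_consecutive _ hca.le haj.le]
    have : 0 < ∑ m ∈ Finset.Ico a j, dist (v m) (v (m + 1)) := by
      apply Finset.sum_pos
      · intro m hm
        rw [Finset.mem_Ico] at hm
        refine dist_pos.mpr fun h => ?_
        have := hv ⟨by omega, by omega⟩ ⟨by omega, by omega⟩ h
        omega
      · exact ⟨a, Finset.mem_Ico.mpr ⟨le_rfl, haj⟩⟩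
    linarith
  have hlt : dG v i j c j < dP v c j := by linarith
  refine ⟨hlt, ?_⟩
  have h4 : dP v j j = 0 := by simp [dP]
  have h5 : dP v c i = dP v i c := by simp [dP, min_comm, max_comm]
  have h6 : 0 ≤ dP v i j := Finset.sum_nonneg fun _ _ => dist_nonneg
  have h7 : 0 ≤ dist (v i) (v j) := dist_nonneg
  unfold dG at hlt ⊢
  rw [h4, h5] at hlt ⊢
  rcases min_choice (dP v c j) (min (dP v i c + dist (v i) (v j) + 0)
    (dP v c j + dist (v i) (v j) + dP v i j)) with h | h
  · linarith
  · rw [h] at hlt ⊢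
    rcases min_choice (dP v i c + dist (v i) (v j) + 0)
      (dP v c j + dist (v i) (v j) + dP v i j) with h | h
    · rw [h]; ring
    · linarith
end

section
/- Let 1 ≤ i < c < j ≤ n. Then for every k with 1 < k ≤ i, d_{G(i,j)}(c,k) < d_{G(i,j)}(c,1), and for every k with j ≤ k < n, d_{G(i,j)}(c,k) < d_{G(i,j)}(c,n). Consequently, any farthest vertex of v_c in G(i,j) has index 1, index n, or an index strictly between i and j. -/
theorem dP_lt_left {X : Type*} [MetricSpace X] (n : ℕ) (v : ℕ → X)
    (hpos : ∀ m : ℕ, 1 ≤ m → m < n → 0 < dist (v m) (v (m + 1)))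
    (a k : ℕ) (h1 : 1 < k) (hk : k ≤ a) (ha : a ≤ n) : dP v a k < dP v a 1 := by
  unfold dP
  rw [min_eq_right hk, max_eq_left hk, min_eq_right (by omega : 1 ≤ a),
    max_eq_left (by omega : 1 ≤ a)]
  refine Finset.sum_lt_sum_of_subset (i := 1) (Finset.Ico_subset_Ico_left h1.le) ?_ ?_
    (hpos 1 le_rfl (by omega)) (fun _ _ _ => dist_nonneg)
  · simp; omega
  · simp; omega

theorem dP_lt_right {X : Type*} [MetricSpace X] (n : ℕ) (v : ℕ → X)
    (hpos : ∀ m : ℕ, 1 ≤ m → m < n → 0 < dist (v m) (v (m + 1)))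
    (a k : ℕ) (h1 : 1 ≤ a) (hk : a ≤ k) (ha : k < n) : dP v a k < dP v a n := by
  unfold dP
  rw [min_eq_left hk, max_eq_right hk, min_eq_left (by omega : a ≤ n),
    max_eq_right (by omega : a ≤ n)]
  refine Finset.sum_lt_sum_of_subset (i := k) (Finset.Ico_subset_Ico_right ha.le) ?_ ?_
    (hpos k (by omega) ha) (fun _ _ _ => dist_nonneg)
  · simp; omega
  · simp

/-- for a center index `c ∈ (i,j)`, vertices in `(1,i]` are
strictly closer than `v_1` and vertices in `[j,n)` strictly closer than `v_n`;
hence any farthest vertex of `v_c` has index `1`, `n`, or lies in `(i,j)`. -/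
theorem stmt_14 {X : Type*} [MetricSpace X] (n : ℕ) (hn : 2 ≤ n) (v : ℕ → X)
    (hv : Set.InjOn v (Set.Icc 1 n))
    (hpos : ∀ m : ℕ, 1 ≤ m → m < n → 0 < dist (v m) (v (m + 1)))
    (i c j : ℕ) (hi : 1 ≤ i) (hic : i < c) (hcj : c < j) (hjn : j ≤ n) :
    (∀ k : ℕ, 1 < k → k ≤ i → dG v i j c k < dG v i j c 1) ∧
    (∀ k : ℕ, j ≤ k → k < n → dG v i j c k < dG v i j c n) ∧
    (∀ k : ℕ, 1 ≤ k → k ≤ n →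
      (∀ m : ℕ, 1 ≤ m → m ≤ n → dG v i j c m ≤ dG v i j c k) →
      k = 1 ∨ k = n ∨ (i < k ∧ k < j)) := by
  have A : ∀ k : ℕ, 1 < k → k ≤ i → dG v i j c k < dG v i j c 1 := by
    intro k h1 hk
    have e1 := dP_lt_left n v hpos c k h1 (by omega) (by omega)
    have e2 := dP_lt_left n v hpos j k h1 (by omega) (by omega)
    have e3 := dP_lt_left n v hpos i k h1 (by omega) (by omega)
    unfold dG
    exact min_lt_min e1 (min_lt_min (by linarith) (by linarith))
  have B : ∀ k : ℕ, j ≤ k → k < n → dG v i j c k < dG v i j c n := by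
    intro k h1 hk
    have e1 := dP_lt_right n v hpos c k (by omega) (by omega) hk
    have e2 := dP_lt_right n v hpos j k (by omega) (by omega) hk
    have e3 := dP_lt_right n v hpos i k (by omega) (by omega) hk
    unfold dG
    exact min_lt_min e1 (min_lt_min (by linarith) (by linarith))
  refine ⟨A, B, fun k h1 hk hm => ?_⟩
  by_contra hcon
  by_cases h : k ≤ i
  · exact absurd (hm 1 le_rfl (by omega)) (not_le.mpr (A k (by omega) h))
  · exact absurd (hm n (by omega) le_rfl) (not_le.mpr (B k (by omega) (by omega)))
end

section
/- (Nested-cycle monotonicity) Let 1 ≤ i ≤ i' < j' ≤ j ≤ n. Then |C(i',j')| ≤ |C(i,j)|, and for all a, b with i' ≤ a, b ≤ j', d_{C(i',j')}(a,b) ≤ d_{C(i,j)}(a,b). -/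
/-- Total length of the cycle `C(i,j)`. -/
noncomputable def cycLen {X : Type*} [MetricSpace X] (v : ℕ → X) (i j : ℕ) : ℝ :=
  dP v i j + dist (v i) (v j)

/-- Distance in the cycle `C(i,j)` between vertices `a, b` with `i ≤ a, b ≤ j`. -/
noncomputable def dC {X : Type*} [MetricSpace X] (v : ℕ → X) (i j a b : ℕ) : ℝ :=
  min (dP v a b) (cycLen v i j - dP v a b)

/-- Nested-cycle monotonicity: for `i ≤ i' < j' ≤ j`,
`|C(i',j')| ≤ |C(i,j)|` and cycle distances only decrease. -/
theorem stmt_15 {X : Type*} [MetricSpace X] (n : ℕ) (hn : 2 ≤ n) (v : ℕ → X)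
    (hv : Set.InjOn v (Set.Icc 1 n))
    (i i' j' j : ℕ) (hi : 1 ≤ i) (hii' : i ≤ i') (hi'j' : i' < j') (hj'j : j' ≤ j)
    (hjn : j ≤ n) :
    cycLen v i' j' ≤ cycLen v i j ∧
    (∀ a b : ℕ, i' ≤ a → a ≤ j' → i' ≤ b → b ≤ j' →
      dC v i' j' a b ≤ dC v i j a b) := by
  have key : cycLen v i' j' ≤ cycLen v i j := by
    unfold cycLen dP
    rw [min_eq_left (by omega), max_eq_right (by omega), min_eq_left (by omega),
      max_eq_right (by omega)]
    have h1 := dist_le_Ico_sum_dist v hii'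
    have h2 := dist_le_Ico_sum_dist v hj'j
    have e1 := Finset.sum_Ico_consecutive (fun m => dist (v m) (v (m + 1))) hii' hi'j'.le
    have e2 := Finset.sum_Ico_consecutive (fun m => dist (v m) (v (m + 1)))
      (hii'.trans hi'j'.le) hj'j
    have t1 := dist_triangle (v i') (v i) (v j')
    have t2 := dist_triangle (v i) (v j) (v j')
    rw [dist_comm (v i') (v i)] at t1
    rw [dist_comm (v j) (v j')] at t2
    linarith
  refine ⟨key, fun a b _ _ _ _ => ?_⟩
  unfold dC
  exact min_le_min le_rfl (by linarith)
end
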